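/- Baseline Shapley preserves the increasing marginal axiom: let f : (Fin n → ℝ) → ℝ be smooth with ∂f/∂x_α ≥ 0 and ∂²f/∂x_α² ≥ 0 everywhere (increasing marginal effect in coordinate α). Then for any baseline x', any vector of other coordinates x̄_{¬α}, and any two values x̄_α > x*_α > x'_α, one has BS_α((x̄_α, x̄_{¬α}), x', f) / (x̄_α − x'_α) ≥ BS_α((x*_α, x̄_{¬α}), x', f) / (x*_α − x'_α). -/

import Mathlib

open Finset

/-- Baseline Shapley attribution: `v(S) = f(x̄_S ; x'_{N∖S})`. -/
noncomputable def BShap {n : ℕ} (xbar x' : Fin n → ℝ) (f : (Fin n → ℝ) → ℝ) (i : Fin n) : ℝ :=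
  ∑ S ∈ (Finset.univ.erase i).powerset,
    ((S.card.factorial * (n - S.card - 1).factorial : ℝ) / (n.factorial : ℝ)) *
      (f (fun j => if j ∈ insert i S then xbar j else x' j) -
       f (fun j => if j ∈ S then xbar j else x' j))

theorem hasDerivAt_comp_update {n : ℕ} {f : (Fin n → ℝ) → ℝ} (hf : Differentiable ℝ f)
    (y : Fin n → ℝ) (α : Fin n) (t : ℝ) :
    HasDerivAt (fun s => f (Function.update y α s))
      (fderiv ℝ f (Function.update y α t) (Pi.single α 1)) t :=
  (hf _).hasFDerivAt.comp_hasDerivAt t (hasDerivAt_update y α t)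

theorem convexOn_comp_update {n : ℕ} {f : (Fin n → ℝ) → ℝ} {α : Fin n} (hf : ContDiff ℝ 2 f)
    (hd2 : ∀ x : Fin n → ℝ,
      0 ≤ fderiv ℝ (fun y => fderiv ℝ f y (Pi.single α 1)) x (Pi.single α 1))
    (y : Fin n → ℝ) : ConvexOn ℝ Set.univ (fun s => f (Function.update y α s)) := by
  have hf1 : Differentiable ℝ f := hf.differentiable (by norm_num)
  have hf2 : Differentiable ℝ (fun y => fderiv ℝ f y (Pi.single α 1)) :=
    ((hf.fderiv_right (m := 1) (by norm_num)).differentiable (by norm_num)).clm_apply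
      (differentiable_const _)
  have hderiv : deriv (fun s => f (Function.update y α s)) =
      fun s => fderiv ℝ f (Function.update y α s) (Pi.single α 1) :=
    funext fun s => (hasDerivAt_comp_update hf1 y α s).deriv
  refine Monotone.convexOn_univ_of_deriv
    (fun s => (hasDerivAt_comp_update hf1 y α s).differentiableAt) ?_
  rw [hderiv]
  refine monotone_of_deriv_nonneg
    (fun s => (hasDerivAt_comp_update hf2 y α s).differentiableAt) fun s => ?_
  rw [(hasDerivAt_comp_update hf2 y α s).deriv]
  exact hd2 _

theorem BShap_update {n : ℕ} (xbar x' : Fin n → ℝ) (f : (Fin n → ℝ) → ℝ) (α : Fin n) (c : ℝ) :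
    BShap (Function.update xbar α c) x' f α =
      ∑ S ∈ (Finset.univ.erase α).powerset,
        ((S.card.factorial * (n - S.card - 1).factorial : ℝ) / (n.factorial : ℝ)) *
          (f (Function.update (fun j => if j ∈ S then xbar j else x' j) α c) -
           f (Function.update (fun j => if j ∈ S then xbar j else x' j) α (x' α))) := by
  refine Finset.sum_congr rfl fun S hS => ?_
  have hα : α ∉ S := fun h => by simpa using Finset.mem_powerset.mp hS h
  congr 3 <;> funext j <;> rcases eq_or_ne j α with rfl | hj <;> simp [*]

/-- Baseline Shapley preserves the increasing marginal axiom. -/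
theorem bshap_increasing_marginal {n : ℕ}
    (f : (Fin n → ℝ) → ℝ) (α : Fin n)
    (hsmooth : ContDiff ℝ (⊤ : ℕ∞) f)
    (hd1 : ∀ x : Fin n → ℝ, 0 ≤ fderiv ℝ f x (Pi.single α 1))
    (hd2 : ∀ x : Fin n → ℝ,
      0 ≤ fderiv ℝ (fun y => fderiv ℝ f y (Pi.single α 1)) x (Pi.single α 1))
    (x' xbar : Fin n → ℝ) (xb xs : ℝ)
    (h1 : xs < xb) (h2 : x' α < xs) :
    BShap (Function.update xbar α xs) x' f α / (xs - x' α) ≤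
      BShap (Function.update xbar α xb) x' f α / (xb - x' α) := by
  rw [BShap_update, BShap_update, Finset.sum_div, Finset.sum_div]
  refine Finset.sum_le_sum fun S _ => ?_
  rw [mul_div_assoc (_ / _), mul_div_assoc (_ / _)]
  have hf : ContDiff ℝ 2 f := contDiff_infty.mp hsmooth 2
  exact mul_le_mul_of_nonneg_left ((convexOn_comp_update hf hd2 _).secant_mono
    (Set.mem_univ _) (Set.mem_univ _) (Set.mem_univ _) h2.ne' (h2.trans h1).ne' h1.le)
    (by positivity)
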